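/- Existence of a fixed point via a priori bound: Let $X$ be a Banach algebra, $r > 0$, and $A, B : \overline{B_r(0)} \to X$ satisfy the hypotheses of the Dhage fixed point theorem ($A$ Lipschitz with constant $L_A$, $B$ compact and continuous, $L_A M < 1$ with $M = \sup_{\|x\|\le r}\|Bx\|$). Assume additionally that for every $\lambda \in (0,1)$ and every $x$ with $\|x\| = r$, one has $\lambda (Ax \cdot Bx) \ne x$. Then there exists $x \in \overline{B_r(0)}$ with $Ax \cdot Bx = x$. -/

import Mathlib

open MeasureTheory Metric

theorem dh_poly {E : Type*} [NormedAddCommGroup E] [NormedSpace ℝ E] [FiniteDimensional ℝ E]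
    (M : E →L[ℝ] E) : ∃ p : Polynomial ℝ, p.natDegree ≤ Module.finrank ℝ E ∧
      ∀ t : ℝ, p.eval t = (ContinuousLinearMap.id ℝ E + t • M).det := by
  classical
  let b := Module.finBasis ℝ E
  let A := LinearMap.toMatrix b b (M : E →ₗ[ℝ] E)
  refine ⟨Matrix.det ((Polynomial.X : Polynomial ℝ) • A.map Polynomial.C
    + (1 : Matrix _ _ ℝ).map Polynomial.C), ?_, ?_⟩
  · simpa using Polynomial.natDegree_det_X_add_C_le A 1
  · intro t
    rw [ContinuousLinearMap.det, ← LinearMap.det_toMatrix b]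
    rw [← Polynomial.coe_evalRingHom, RingHom.map_det]
    congr 1
    ext i j
    simp [A, LinearMap.toMatrix_apply, Matrix.one_apply, Finsupp.single_apply, apply_ite]
    grind

theorem dh_interp (N : ℕ) (δ : ℝ) (hδ : 0 < δ) : ∃ (s : Finset ℝ) (w : ℝ → ℝ),
    (∀ t ∈ s, 0 < t ∧ t < δ) ∧ ∀ p : Polynomial ℝ, p.natDegree ≤ N →
      p.eval 1 = ∑ t ∈ s, w t * p.eval t := by
  obtain ⟨s, hs, hc⟩ := (Set.Ioo_infinite hδ).exists_subset_card_eq (N + 1)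
  refine ⟨s, fun t => (Lagrange.basis s id t).eval 1, fun t ht => hs ht, fun p hp => ?_⟩
  have h := Lagrange.eq_interpolate (f := p) (s := s) (v := (id : ℝ → ℝ))
    (Function.injective_id.injOn) (by
      rw [hc]; exact lt_of_le_of_lt Polynomial.degree_le_natDegree (by exact_mod_cast Nat.lt_succ_of_le hp))
  conv_lhs => rw [h]
  rw [Lagrange.interpolate_apply, Polynomial.eval_finsetSum]
  refine Finset.sum_congr rfl fun t _ => ?_
  simp [mul_comm]

theorem dh_change {E : Type*} [NormedAddCommGroup E] [InnerProductSpace ℝ E] [FiniteDimensional ℝ E]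
    [MeasurableSpace E] [BorelSpace E] (g : E → E) (hg : ContDiff ℝ 1 g) (R : ℝ)
    (hR : ∀ x, R < ‖x‖ → g x = 0) :
    ∃ δ > 0, ∀ t : ℝ, 0 < t → t < δ → ∀ h : E → ℝ,
      ∫ x in closedBall (0:E) R, (ContinuousLinearMap.id ℝ E + t • fderiv ℝ g x).det * h (x + t • g x)
        = ∫ x in closedBall (0:E) R, h x := by
  have hcs : HasCompactSupport g := HasCompactSupport.of_support_subset_isCompact
    (isCompact_closedBall (0:E) R) (fun x hx => by
      by_contra hc
      simp at hc
      exact hx (hR x hc))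
  obtain ⟨K, hK⟩ := hg.lipschitzWith_of_hasCompactSupport hcs (by simp)
  have hdc : Continuous (fun M : E →L[ℝ] E => (ContinuousLinearMap.id ℝ E + M).det) :=
    ContinuousLinearMap.continuous_det.comp (by fun_prop)
  have h0 : ∀ᶠ M : E →L[ℝ] E in nhds 0, 0 < (ContinuousLinearMap.id ℝ E + M).det := by
    refine hdc.continuousAt.eventually (lt_mem_nhds ?_)
    simp [ContinuousLinearMap.det]
  obtain ⟨η, hη, hdet⟩ := Metric.eventually_nhds_iff.1 h0
  refine ⟨min 1 η / (K + 1), by positivity, fun t ht htδ h => ?_⟩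
  rw [lt_div_iff₀ (by positivity)] at htδ
  have hKt : t * K < min 1 η := by nlinarith
  have hfd : ∀ x, ‖fderiv ℝ g x‖ ≤ K := fun x => norm_fderiv_le_of_lipschitz ℝ hK
  have hpos : ∀ x, 0 < (ContinuousLinearMap.id ℝ E + t • fderiv ℝ g x).det := by
    intro x
    apply hdet
    rw [dist_zero_right, norm_smul, Real.norm_of_nonneg ht.le]
    calc t * _ ≤ t * K := by gcongr; exact hfd x
      _ < η := hKt.trans_le (min_le_right _ _)
  have happ : ApproximatesLinearOn (fun x => x + t • g x)
      ((ContinuousLinearEquiv.refl ℝ E : E ≃L[ℝ] E) : E →L[ℝ] E) Set.univ (t.toNNReal * K) := by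
    intro x _ y _
    have := hK.dist_le_mul x y
    rw [dist_eq_norm, dist_eq_norm] at this
    simp only [ContinuousLinearEquiv.coe_refl, ContinuousLinearMap.coe_id', id]
    rw [show x + t • g x - (y + t • g y) - (x - y) = t • (g x - g y) by rw [smul_sub]; abel,
      norm_smul, Real.norm_of_nonneg ht.le]
    simp [ht.le]
    rw [mul_assoc]; gcongr
  have hc : Subsingleton E ∨ t.toNNReal * K < ‖((ContinuousLinearEquiv.refl ℝ E).symm : E →L[ℝ] E)‖₊⁻¹ := by
    rcases subsingleton_or_nontrivial E with h | h
    · exact Or.inl h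
    · right
      simp
      rw [← NNReal.coe_lt_coe]
      simp [ht.le]
      exact hKt.trans_le (min_le_left _ _)
  have hbij : Function.Bijective (fun x => x + t • g x) := (happ.toHomeomorph _ hc).bijective
  have himg : (fun x => x + t • g x) '' closedBall (0:E) R = closedBall 0 R := by
    ext y
    constructor
    · rintro ⟨x, hx, rfl⟩
      by_contra hy
      simp only [mem_closedBall, dist_zero_right, not_le] at hx hy
      have := hbij.1 (a₁ := x) (a₂ := x + t • g x) (by simp only [hR _ hy]; simp)
      rw [← this] at hy
      linarith
    · intro hy
      obtain ⟨x, hx⟩ := hbij.2 y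
      refine ⟨x, ?_, hx⟩
      by_contra hxR
      simp only [mem_closedBall, dist_zero_right, not_le] at hxR hy
      simp only [hR _ hxR] at hx
      simp at hx; subst hx; linarith
  have := integral_image_eq_integral_abs_det_fderiv_smul (volume : Measure E)
    (s := closedBall (0:E) R) (f := fun x => x + t • g x)
    (f' := fun x => ContinuousLinearMap.id ℝ E + t • fderiv ℝ g x) measurableSet_closedBall
    (fun x _ => by
      have := ((hg.differentiable (by simp)) x).hasFDerivAt
      exact ((hasFDerivAt_id x).add (this.const_smul t)).hasFDerivWithinAt)
    hbij.1.injOn h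
  rw [himg] at this
  rw [this]
  refine integral_congr_ae (Filter.Eventually.of_forall fun x => ?_)
  simp [abs_of_pos (hpos x)]

theorem dh_change1 {E : Type*} [NormedAddCommGroup E] [InnerProductSpace ℝ E] [FiniteDimensional ℝ E]
    [MeasurableSpace E] [BorelSpace E] (g : E → E) (hg : ContDiff ℝ 1 g) (R : ℝ)
    (hR : ∀ x, R < ‖x‖ → g x = 0) (c : ℝ) (m : ℕ) :
      ∫ x in closedBall (0:E) R, (ContinuousLinearMap.id ℝ E + fderiv ℝ g x).det *
          (1 - c * ‖x + g x‖ ^ 2) ^ m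
        = ∫ x in closedBall (0:E) R, (1 - c * ‖x‖ ^ 2) ^ m := by
  obtain ⟨δ, hδ, H⟩ := dh_change g hg R hR
  obtain ⟨s, w, hs, hw⟩ := dh_interp (Module.finrank ℝ E + m * 2) δ hδ
  have key : ∀ x, (ContinuousLinearMap.id ℝ E + fderiv ℝ g x).det * (1 - c * ‖x + g x‖ ^ 2) ^ m
      = ∑ t ∈ s, w t * ((ContinuousLinearMap.id ℝ E + t • fderiv ℝ g x).det *
        (1 - c * ‖x + t • g x‖ ^ 2) ^ m) := by
    intro x
    obtain ⟨p, hp, hpe⟩ := dh_poly (fderiv ℝ g x)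
    let q : Polynomial ℝ := Polynomial.C (1 - c * ‖x‖ ^ 2)
      + Polynomial.C (- c * (2 * inner ℝ x (g x))) * Polynomial.X
      + Polynomial.C (- c * ‖g x‖ ^ 2) * Polynomial.X ^ 2
    have hq : q.natDegree ≤ 2 := by simp only [q]; compute_degree
    have hqe : ∀ t, q.eval t = 1 - c * ‖x + t • g x‖ ^ 2 := by
      intro t
      rw [norm_add_sq_real, inner_smul_right, norm_smul, mul_pow, Real.norm_eq_abs, sq_abs]
      simp [q]; ring
    have := hw (p * q ^ m) (Polynomial.natDegree_mul_le.trans (add_le_add hp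
      (Polynomial.natDegree_pow_le.trans (Nat.mul_le_mul_left m hq))))
    simpa [hpe, hqe] using this
  have hw1 : ∑ t ∈ s, w t = 1 := by
    have := hw 1 (by simp)
    simpa using this.symm
  simp_rw [key]
  rw [integral_finsetSum]
  · calc _ = ∑ t ∈ s, w t * ∫ x in closedBall (0:E) R, (1 - c * ‖x‖ ^ 2) ^ m := by
          refine Finset.sum_congr rfl fun t ht => ?_
          rw [integral_const_mul, H t (hs t ht).1 (hs t ht).2 (fun y => (1 - c * ‖y‖ ^ 2) ^ m)]
      _ = _ := by rw [← Finset.sum_mul, hw1, one_mul]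
  · intro t _
    refine ContinuousOn.integrableOn_compact (isCompact_closedBall _ _) (Continuous.continuousOn ?_)
    have h1 : Continuous (fderiv ℝ g) := hg.continuous_fderiv (by simp)
    have h2 : Continuous fun x => (ContinuousLinearMap.id ℝ E + t • fderiv ℝ g x).det :=
      ContinuousLinearMap.continuous_det.comp (by fun_prop)
    have := hg.continuous
    fun_prop

theorem dh_zero {E : Type*} [NormedAddCommGroup E] [InnerProductSpace ℝ E] [FiniteDimensional ℝ E]
    [MeasurableSpace E] [BorelSpace E] (g : E → E) (hg : ContDiff ℝ 1 g) (R : ℝ) (hR0 : 0 < R)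
    (hR : ∀ x, R < ‖x‖ → g x = 0) : ∃ x, x + g x = 0 := by
  by_contra hne
  push Not at hne
  have hgc := hg.continuous
  have hK := isCompact_closedBall (0:E) R
  have hKne : (closedBall (0:E) R).Nonempty := ⟨0, by simp [hR0.le]⟩
  obtain ⟨x0, hx0, hmin⟩ := hK.exists_isMinOn hKne
    (f := fun x => ‖x + g x‖) (by fun_prop)
  obtain ⟨x1, hx1, hmax⟩ := hK.exists_isMaxOn hKne
    (f := fun x => ‖x + g x‖) (by fun_prop)
  have hdc : Continuous fun x => (ContinuousLinearMap.id ℝ E + fderiv ℝ g x).det := by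
    have h1 : Continuous (fderiv ℝ g) := hg.continuous_fderiv (by simp)
    exact ContinuousLinearMap.continuous_det.comp (by fun_prop)
  obtain ⟨D, hD⟩ := hK.exists_bound_of_continuousOn hdc.continuousOn
  set ε := ‖x0 + g x0‖ with hε
  set S := ‖x1 + g x1‖ with hS
  have hε0 : 0 < ε := norm_pos_iff.2 (hne x0)
  have hεS : ε ≤ S := hmin hx1
  set c : ℝ := 1 / (S ^ 2 + R ^ 2) with hc
  have hc0 : 0 < c := by positivity
  have hcS : c * S ^ 2 ≤ 1 := by
    rw [hc, div_mul_eq_mul_div, div_le_one (by positivity)]; nlinarith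
  have hcR : c * R ^ 2 ≤ 1 := by
    rw [hc, div_mul_eq_mul_div, div_le_one (by positivity)]; nlinarith
  have hcε : c * ε ^ 2 ≤ 1 := le_trans (by gcongr) hcS
  set ρ := min ε R / 2 with hρ
  have hρ0 : 0 < ρ := by positivity
  have hρε : ρ ≤ ε / 2 := by rw [hρ]; linarith [min_le_left ε R]
  have hρR : ρ ≤ R := by rw [hρ]; linarith [min_le_right ε R]
  set a := 1 - c * ε ^ 2 with ha
  set b := 1 - c * (ε / 2) ^ 2 with hb
  have ha0 : 0 ≤ a := by linarith
  have hce : 0 < c * ε ^ 2 := by positivity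
  have hab : a < b := by rw [ha, hb]; nlinarith
  have hb0 : 0 < b := lt_of_le_of_lt ha0 hab
  set V := volume.real (closedBall (0:E) R)
  set v := volume.real (closedBall (0:E) ρ)
  have hv : 0 < v := by
    apply ENNReal.toReal_pos
    · exact (measure_closedBall_pos _ _ hρ0).ne'
    · exact (isCompact_closedBall _ _).measure_lt_top.ne
  have hD0 : 0 ≤ D := (norm_nonneg _).trans (hD x0 hx0)
  have main : ∀ m : ℕ, b ^ m * v ≤ D * V * a ^ m := by
    intro m
    have h1 := dh_change1 g hg R hR c m
    have h2 : b ^ m * v ≤ ∫ x in closedBall (0:E) R, (1 - c * ‖x‖ ^ 2) ^ m := by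
      calc b ^ m * v = ∫ x in closedBall (0:E) ρ, b ^ m := by
            rw [setIntegral_const, smul_eq_mul, mul_comm]
        _ ≤ ∫ x in closedBall (0:E) ρ, (1 - c * ‖x‖ ^ 2) ^ m := by
            refine setIntegral_mono_on ?_ ?_ measurableSet_closedBall ?_
            · exact ContinuousOn.integrableOn_compact (isCompact_closedBall _ _) (by fun_prop)
            · exact ContinuousOn.integrableOn_compact (isCompact_closedBall _ _) (by fun_prop)
            · intro x hx
              simp only [mem_closedBall, dist_zero_right] at hx
              have : ‖x‖ ≤ ε / 2 := hx.trans hρε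
              simp only [hb] at hb0 ⊢
              gcongr
        _ ≤ _ := by
            refine setIntegral_mono_set ?_ ?_ ?_
            · exact ContinuousOn.integrableOn_compact (isCompact_closedBall _ _) (by fun_prop)
            · refine (ae_restrict_iff' measurableSet_closedBall).2 (Filter.Eventually.of_forall ?_)
              intro x hx
              simp only [mem_closedBall, dist_zero_right] at hx
              have : c * ‖x‖ ^ 2 ≤ c * R ^ 2 := by gcongr
              exact pow_nonneg (by linarith) _
            · exact (closedBall_subset_closedBall hρR).eventuallyLE
    have h3 : ‖∫ x in closedBall (0:E) R, (ContinuousLinearMap.id ℝ E + fderiv ℝ g x).det *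
          (1 - c * ‖x + g x‖ ^ 2) ^ m‖ ≤ (D * a ^ m) * V := by
      refine norm_setIntegral_le_of_norm_le_const (isCompact_closedBall _ _).measure_lt_top ?_
      intro x hx
      rw [norm_mul]
      have hl : ε ≤ ‖x + g x‖ := hmin hx
      have hu : ‖x + g x‖ ≤ S := hmax hx
      have h4 : c * ‖x + g x‖ ^ 2 ≤ c * S ^ 2 := by gcongr
      have h5 : c * ε ^ 2 ≤ c * ‖x + g x‖ ^ 2 := by gcongr
      have h6 : 0 ≤ 1 - c * ‖x + g x‖ ^ 2 := by linarith
      rw [Real.norm_of_nonneg (pow_nonneg h6 m)]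
      refine mul_le_mul (hD x hx) (pow_le_pow_left₀ h6 (by linarith) m) (pow_nonneg h6 m) hD0
    rw [h1] at h3
    calc _ ≤ _ := h2
      _ ≤ _ := le_abs_self _
      _ ≤ _ := h3
      _ = _ := by ring
  have hlim : Filter.Tendsto (fun m : ℕ => D * V * (a / b) ^ m) Filter.atTop (nhds (D * V * 0)) :=
    (tendsto_pow_atTop_nhds_zero_of_lt_one (by positivity) ((div_lt_one hb0).2 hab)).const_mul _
  have : v ≤ D * V * 0 := by
    refine ge_of_tendsto' hlim fun m => ?_
    rw [div_pow, mul_div_assoc', le_div_iff₀ (by positivity)]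
    linarith [main m]
  linarith

theorem dh_brouwer_ball {E : Type*} [NormedAddCommGroup E] [InnerProductSpace ℝ E]
    [FiniteDimensional ℝ E] (f : E → E) (hf : Continuous f) (hf1 : ∀ x, ‖f x‖ ≤ 1) :
    ∃ x, f x = x := by
  by_contra hne
  push Not at hne
  let _ : MeasurableSpace E := borel E
  have : BorelSpace E := ⟨rfl⟩
  obtain ⟨x0, hx0, hmin⟩ := (isCompact_closedBall (0:E) 2).exists_isMinOn ⟨0, by simp⟩
    (f := fun x => ‖f x - x‖) (by fun_prop)
  have hd : 0 < ‖f x0 - x0‖ := norm_pos_iff.2 (sub_ne_zero.2 (hne x0))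
  obtain ⟨φ, hφ, hφf, -⟩ := hf.exists_contDiff_approx 1 (ε := fun _ => min 1 ‖f x0 - x0‖)
    continuous_const (fun _ => by positivity)
  let χ : ContDiffBump (0:E) := ⟨2, 3, by norm_num, by norm_num⟩
  obtain ⟨x, hx⟩ := dh_zero (fun x => -(χ x • φ x)) (by
      have : ContDiff ℝ 1 χ := χ.contDiff
      have h2 : ContDiff ℝ 1 φ := hφ
      fun_prop) 3 (by norm_num) (fun x hx => by
      rw [χ.zero_of_le_dist (by simpa using hx.le)]; simp)
  have hx' : x = χ x • φ x := by rwa [← sub_eq_add_neg, sub_eq_zero] at hx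
  have h1 := hφf x
  rw [dist_eq_norm] at h1
  have h2 : ‖φ x‖ ≤ 2 := by
    have := norm_sub_norm_le (φ x) (f x)
    have := hf1 x
    have := min_le_left 1 ‖f x0 - x0‖
    linarith
  have h3 : ‖x‖ ≤ 2 := by
    rw [hx', norm_smul, Real.norm_of_nonneg χ.nonneg]
    calc _ ≤ 1 * ‖φ x‖ := by gcongr; exact χ.le_one
      _ ≤ 2 := by linarith
  rw [χ.one_of_mem_closedBall (by simpa using h3), one_smul] at hx'
  rw [← hx', norm_sub_rev] at h1
  have h4 : ‖f x0 - x0‖ ≤ ‖f x - x‖ := hmin (by simpa using h3)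
  linarith [min_le_right 1 ‖f x0 - x0‖]

theorem dh_brouwer_simplex {ι : Type*} [Fintype ι] [Nonempty ι] (f : (ι → ℝ) → (ι → ℝ))
    (hf : ContinuousOn f (stdSimplex ℝ ι)) (hm : Set.MapsTo f (stdSimplex ℝ ι) (stdSimplex ℝ ι)) :
    ∃ x ∈ stdSimplex ℝ ι, f x = x := by
  classical
  let P : (ι → ℝ) → ℝ := fun x => ∑ i, max (x i) 0
  let T : (ι → ℝ) → ℝ := fun x => max (P x) 1
  let r : (ι → ℝ) → (ι → ℝ) := fun x i => (max (x i) 0 + (T x - P x) / Fintype.card ι) / T x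
  have hT : ∀ x, 0 < T x := fun x => lt_of_lt_of_le one_pos (le_max_right _ _)
  have hPc : Continuous P := by fun_prop
  have hTc : Continuous T := by fun_prop
  have hrc : Continuous r := by
    refine continuous_pi fun i => ?_
    exact Continuous.div (by fun_prop) hTc (fun x => (hT x).ne')
  have hrm : ∀ x, r x ∈ stdSimplex ℝ ι := by
    intro x
    refine ⟨fun i => ?_, ?_⟩
    · have : P x ≤ T x := le_max_left _ _
      have := hT x
      have : 0 ≤ (T x - P x) / Fintype.card ι := div_nonneg (by linarith) (by positivity)
      have : 0 ≤ max (x i) 0 := le_max_right _ _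
      simp only [r]; positivity
    · simp only [r]
      rw [← Finset.sum_div, Finset.sum_add_distrib, div_eq_one_iff_eq (hT x).ne']
      have : (Fintype.card ι : ℝ) ≠ 0 := by positivity
      simp
      field_simp
      simp [P]
  have hrid : ∀ x ∈ stdSimplex ℝ ι, r x = x := by
    intro x hx
    have hp : P x = 1 := by
      rw [← hx.2]; exact Finset.sum_congr rfl fun i _ => max_eq_left (hx.1 i)
    have ht : T x = 1 := by simp [T, hp]
    ext i
    simp [r, hp, ht, hx.1 i]
  let F : EuclideanSpace ℝ ι → EuclideanSpace ℝ ι := fun x => WithLp.toLp 2 (f (r (WithLp.ofLp x)))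
  obtain ⟨x, hx⟩ := dh_brouwer_ball F (by
      have : Continuous fun y => f (r y) := hf.comp_continuous hrc hrm
      have := this.comp (PiLp.continuous_ofLp 2 (fun _ : ι => ℝ))
      exact (PiLp.continuous_toLp 2 (fun _ : ι => ℝ)).comp this) (fun x => by
      have h := hm (hrm (WithLp.ofLp x))
      rw [EuclideanSpace.norm_eq]
      refine Real.sqrt_le_iff.2 ⟨zero_le_one, ?_⟩
      rw [one_pow]
      simp only [F]
      rw [← h.2]
      refine Finset.sum_le_sum fun i _ => ?_
      have h0 := h.1 i
      have h1 : f (r (WithLp.ofLp x)) i ≤ 1 := by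
        rw [← h.2]; exact Finset.single_le_sum (fun j _ => h.1 j) (Finset.mem_univ i)
      rw [Real.norm_of_nonneg h0]
      nlinarith)
  have hx' : f (r (WithLp.ofLp x)) = WithLp.ofLp x := congrArg WithLp.ofLp hx
  have hmem : WithLp.ofLp x ∈ stdSimplex ℝ ι := by rw [← hx']; exact hm (hrm _)
  exact ⟨_, hmem, by rwa [hrid _ hmem] at hx'⟩

theorem dh_schauder {X : Type*} [NormedAddCommGroup X] [NormedSpace ℝ X] (K : Set X)
    (hK : IsCompact K) (hKc : Convex ℝ K) (hKne : K.Nonempty) (f : X → X)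
    (hf : ContinuousOn f K) (hm : Set.MapsTo f K K) : ∃ x ∈ K, f x = x := by
  obtain ⟨x0, hx0, hmin⟩ := hK.exists_isMinOn hKne
    (f := fun x => ‖f x - x‖) ((hf.sub continuousOn_id).norm)
  refine ⟨x0, hx0, ?_⟩
  by_contra hne
  have hε : 0 < ‖f x0 - x0‖ / 2 := half_pos (norm_pos_iff.2 (sub_ne_zero.2 hne))
  set ε := ‖f x0 - x0‖ / 2
  obtain ⟨t, htK, htf, hcov⟩ := hK.finite_cover_balls hε
  have : Fintype t := htf.fintype
  have hex : ∀ y ∈ K, ∃ i : t, ‖y - i‖ < ε := by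
    intro y hy
    have := hcov hy
    simp only [Set.mem_iUnion, mem_ball, dist_eq_norm] at this
    obtain ⟨i, hi, h⟩ := this
    exact ⟨⟨i, hi⟩, h⟩
  have : Nonempty t := ⟨(hex _ hx0).choose⟩
  let w : t → X → ℝ := fun i y => max (ε - ‖y - i‖) 0
  let W : X → ℝ := fun y => ∑ i, w i y
  have hw0 : ∀ i y, 0 ≤ w i y := fun i y => le_max_right _ _
  have hW : ∀ y ∈ K, 0 < W y := by
    intro y hy
    obtain ⟨i, hi⟩ := hex y hy
    refine Finset.sum_pos' (fun i _ => hw0 i y) ⟨i, Finset.mem_univ _, ?_⟩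
    exact lt_max_of_lt_left (by linarith)
  let pt : (t → ℝ) → X := fun s => ∑ i, s i • (i : X)
  have hpt : ∀ s ∈ stdSimplex ℝ t, pt s ∈ K := fun s hs =>
    hKc.sum_mem (fun i _ => hs.1 i) hs.2 (fun i _ => htK i.2)
  have hptc : Continuous pt := by fun_prop
  have hfp : ContinuousOn (fun s => f (pt s)) (stdSimplex ℝ t) :=
    hf.comp hptc.continuousOn hpt
  obtain ⟨s, hs, hfix⟩ := dh_brouwer_simplex (fun s i => w i (f (pt s)) / W (f (pt s))) (by
      refine continuousOn_pi.2 fun i => ContinuousOn.div ?_ ?_ (fun s hs => (hW _ (hm (hpt s hs))).ne')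
      · have : Continuous (w i) := by fun_prop
        exact this.comp_continuousOn hfp
      · have : Continuous W := by fun_prop
        exact this.comp_continuousOn hfp) (by
      intro s hs
      have := hW _ (hm (hpt s hs))
      refine ⟨fun i => div_nonneg (hw0 _ _) this.le, ?_⟩
      rw [← Finset.sum_div]
      exact div_self this.ne')
  have h1 : ‖f (pt s) - pt s‖ ≤ ε := by
    have e : f (pt s) - pt s = ∑ i, s i • (f (pt s) - i) := by
      simp only [smul_sub, Finset.sum_sub_distrib]
      rw [← Finset.sum_smul, hs.2, one_smul]
    rw [e]
    calc _ ≤ ∑ i, ‖s i • (f (pt s) - i)‖ := norm_sum_le _ _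
      _ ≤ ∑ i, s i * ε := by
          refine Finset.sum_le_sum fun i _ => ?_
          rw [norm_smul, Real.norm_of_nonneg (hs.1 i)]
          by_cases h : ‖f (pt s) - i‖ ≤ ε
          · exact mul_le_mul_of_nonneg_left h (hs.1 i)
          · have : s i = 0 := by
              rw [← hfix]
              have : w i (f (pt s)) = 0 := max_eq_right (by linarith)
              simp [this]
            simp [this]
      _ = ε := by rw [← Finset.sum_mul, hs.2, one_mul]
  have h2 : ‖f x0 - x0‖ ≤ ‖f (pt s) - pt s‖ := hmin (hpt s hs)
  have : ε = ‖f x0 - x0‖ / 2 := rfl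
  linarith

/-- `S` is a finite union of sets of diameter at most `d`. -/
def dhKur {X : Type*} [NormedAddCommGroup X] (S : Set X) (d : ℝ) : Prop :=
  ∃ (n : ℕ) (c : X → Fin n), ∀ x ∈ S, ∀ y ∈ S, c x = c y → ‖x - y‖ ≤ d

theorem dhKur_of {X : Type*} [NormedAddCommGroup X] {S : Set X} {d : ℝ} {ι : Type*} [Finite ι]
    (c : X → ι) (h : ∀ x ∈ S, ∀ y ∈ S, c x = c y → ‖x - y‖ ≤ d) : dhKur S d :=
  ⟨Nat.card ι, fun x => Finite.equivFin ι (c x), fun x hx y hy e =>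
    h x hx y hy ((Finite.equivFin ι).injective e)⟩

theorem dhKur_of' {X : Type*} [NormedAddCommGroup X] {S : Set X} {d : ℝ} {ι : Type*} [Finite ι]
    (q : X → ι → Prop) (hq : ∀ x ∈ S, ∃ i, q x i)
    (h : ∀ x ∈ S, ∀ y ∈ S, ∀ i, q x i → q y i → ‖x - y‖ ≤ d) : dhKur S d := by
  classical
  rcases S.eq_empty_or_nonempty with rfl | ⟨a, ha⟩
  · exact ⟨1, fun _ => 0, by simp⟩
  have : Nonempty ι := ⟨(hq a ha).choose⟩
  have : ∀ x, ∃ i, x ∈ S → q x i := fun x => by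
    by_cases hx : x ∈ S
    · obtain ⟨i, hi⟩ := hq x hx
      exact ⟨i, fun _ => hi⟩
    · exact ⟨Classical.arbitrary ι, fun h => absurd h hx⟩
  choose c hc using this
  exact dhKur_of c fun x hx y hy e => h x hx y hy (c x) (hc x hx) (e ▸ hc y hy)

theorem dhKur.mono {X : Type*} [NormedAddCommGroup X] {S T : Set X} {d e : ℝ} (h : dhKur T e)
    (hST : S ⊆ T) (hde : e ≤ d) : dhKur S d := by
  obtain ⟨n, c, hc⟩ := h
  exact ⟨n, c, fun x hx y hy e => (hc x (hST hx) y (hST hy) e).trans hde⟩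

theorem dhKur.closure {X : Type*} [NormedAddCommGroup X] {S : Set X} {d ε : ℝ} (h : dhKur S d)
    (hε : 0 < ε) : dhKur (closure S) (d + ε) := by
  obtain ⟨n, c, hc⟩ := h
  refine dhKur_of' (ι := Fin n) (fun x i => ∃ p ∈ S, ‖x - p‖ < ε / 2 ∧ c p = i) ?_ ?_
  · intro x hx
    obtain ⟨p, hp, hxp⟩ := Metric.mem_closure_iff.1 hx (ε / 2) (half_pos hε)
    exact ⟨c p, p, hp, by rwa [dist_eq_norm] at hxp, rfl⟩
  · rintro x - y - i ⟨p, hp, hxp, rfl⟩ ⟨q, hq, hyq, e⟩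
    have h1 := hc p hp q hq e.symm
    calc ‖x - y‖ = ‖(x - p) + (p - q) - (y - q)‖ := by congr 1; abel
      _ ≤ ‖(x - p) + (p - q)‖ + ‖y - q‖ := norm_sub_le _ _
      _ ≤ ‖x - p‖ + ‖p - q‖ + ‖y - q‖ := by gcongr; exact norm_add_le _ _
      _ ≤ d + ε := by linarith

theorem dhKur.insert_pt {X : Type*} [NormedAddCommGroup X] {S : Set X} {d : ℝ} (h : dhKur S d)
    (hd : 0 ≤ d) (a : X) : dhKur (insert a S) d := by
  obtain ⟨n, c, hc⟩ := h
  refine dhKur_of' (ι := Option (Fin n))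
    (fun x i => (i = none ∧ x = a) ∨ (x ∈ S ∧ i = some (c x))) ?_ ?_
  · rintro x (rfl | hx)
    · exact ⟨none, Or.inl ⟨rfl, rfl⟩⟩
    · exact ⟨some (c x), Or.inr ⟨hx, rfl⟩⟩
  · rintro x - y - i (⟨rfl, rfl⟩ | ⟨hx, rfl⟩) (⟨h, rfl⟩ | ⟨hy, e⟩)
    · simpa using hd
    · simp at e
    · simp at h
    · exact hc x hx y hy (by simpa using e)

theorem dhKur.join {X : Type*} [NormedAddCommGroup X] [NormedSpace ℝ X] {S T : Set X}
    {d ε R : ℝ} (h : dhKur S d)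
    (hT : ∀ x ∈ T, ∀ y ∈ T, ‖x - y‖ ≤ d) (hSR : ∀ x ∈ S, ‖x‖ ≤ R) (hTR : ∀ x ∈ T, ‖x‖ ≤ R)
    (hε : 0 < ε) : dhKur (convexJoin ℝ T S) (d + ε) := by
  obtain ⟨n, c, hc⟩ := h
  obtain ⟨N, hN⟩ := exists_nat_gt (2 * R / ε)
  refine dhKur_of' (ι := Fin n × Fin (N + 2)) (fun x i => ∃ a ∈ T, ∃ b ∈ S, ∃ l : ℝ, 0 ≤ l ∧ l ≤ 1 ∧
    x = (1 - l) • a + l • b ∧ c b = i.1 ∧ ⌊l * (N + 1)⌋₊ = (i.2 : ℕ)) ?_ ?_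
  · intro x hx
    obtain ⟨a, ha, b, hb, u, v, hu, hv, huv, rfl⟩ := mem_convexJoin.1 hx
    have hv1 : v ≤ 1 := by linarith
    refine ⟨(c b, ⟨⌊v * (N + 1)⌋₊, ?_⟩), a, ha, b, hb, v, hv, hv1, ?_, rfl, rfl⟩
    · rw [Nat.floor_lt (by positivity)]
      push_cast
      nlinarith
    · rw [← huv]; simp
  · rintro x - y - ⟨i, j⟩ ⟨a, ha, b, hb, l, hl0, hl1, rfl, hci, hlj⟩
      ⟨a', ha', b', hb', m, hm0, hm1, rfl, hci', hmj⟩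
    simp only at hci hlj hci' hmj
    have h1 := hT a ha a' ha'
    have h2 := hc b hb b' hb' (hci.trans hci'.symm)
    have hR : 0 ≤ R := (norm_nonneg _).trans (hSR b hb)
    have hN0 : (0:ℝ) < N + 1 := by positivity
    have hlm : |l - m| * (N + 1) ≤ 1 := by
      have e1 := Nat.floor_le (a := l * (N + 1 : ℝ)) (by positivity)
      have e2 := Nat.lt_floor_add_one (l * (N + 1 : ℝ))
      have e3 := Nat.floor_le (a := m * (N + 1 : ℝ)) (by positivity)
      have e4 := Nat.lt_floor_add_one (m * (N + 1 : ℝ))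
      rw [hlj] at e1 e2
      rw [hmj] at e3 e4
      rcases abs_cases (l - m) with ⟨e, -⟩ | ⟨e, -⟩ <;> rw [e] <;> nlinarith
    have h3 : |l - m| * (2 * R) ≤ ε := by
      rw [div_lt_iff₀ hε] at hN
      have := abs_nonneg (l - m)
      calc |l - m| * (2 * R) ≤ |l - m| * ((N + 1) * ε) :=
            mul_le_mul_of_nonneg_left (by linarith) this
        _ = (|l - m| * (N + 1)) * ε := by ring
        _ ≤ 1 * ε := by gcongr
        _ = ε := one_mul _
    calc ‖(1 - l) • a + l • b - ((1 - m) • a' + m • b')‖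
        = ‖((1 - l) • (a - a') + l • (b - b')) + (l - m) • (b' - a')‖ := by
          congr 1; module
      _ ≤ ‖(1 - l) • (a - a') + l • (b - b')‖ + ‖(l - m) • (b' - a')‖ := norm_add_le _ _
      _ ≤ (‖(1 - l) • (a - a')‖ + ‖l • (b - b')‖) + ‖(l - m) • (b' - a')‖ := by
          gcongr; exact norm_add_le _ _
      _ = (1 - l) * ‖a - a'‖ + l * ‖b - b'‖ + |l - m| * ‖b' - a'‖ := by
          rw [norm_smul, norm_smul, norm_smul, Real.norm_of_nonneg hl0,
            Real.norm_of_nonneg (by linarith : 0 ≤ 1 - l), Real.norm_eq_abs]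
      _ ≤ (1 - l) * d + l * d + |l - m| * (2 * R) := by
          have : ‖b' - a'‖ ≤ 2 * R := by
            linarith [norm_sub_le b' a', hSR b' hb', hTR a' ha']
          have : 0 ≤ 1 - l := by linarith
          gcongr
      _ ≤ d + ε := by linarith

theorem dhKur.hull {X : Type*} [NormedAddCommGroup X] [NormedSpace ℝ X] {S : Set X}
    {d ε R : ℝ} (h : dhKur S d) (hSR : ∀ x ∈ S, ‖x‖ ≤ R) (hε : 0 < ε) :
    dhKur (convexHull ℝ S) (d + ε) := by
  classical
  obtain ⟨n, c, hc⟩ := h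
  have hb : ∀ T ⊆ S, ∀ x ∈ convexHull ℝ T, ‖x‖ ≤ R := by
    intro T hT x hx
    have : convexHull ℝ T ⊆ closedBall 0 R :=
      convexHull_min (fun y hy => by simpa using hSR y (hT hy)) (convex_closedBall _ _)
    simpa using this hx
  have key : ∀ s : Finset (Fin n), ∀ ε > 0, dhKur (convexHull ℝ {x ∈ S | c x ∈ s}) (d + ε) := by
    intro s
    induction s using Finset.induction_on with
    | empty => intro ε _; exact ⟨1, fun _ => 0, by simp⟩
    | insert i s _ ih =>
      intro ε hε
      have hT : ∀ x ∈ convexHull ℝ {x ∈ S | c x = i}, ∀ y ∈ convexHull ℝ {x ∈ S | c x = i},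
          ‖x - y‖ ≤ d := by
        intro x hx y hy
        obtain ⟨x', hx', y', hy', hle⟩ := convexHull_exists_dist_ge2 hx hy
        rw [dist_eq_norm, dist_eq_norm] at hle
        exact hle.trans (hc _ hx'.1 _ hy'.1 (hx'.2.trans hy'.2.symm))
      have hu : {x ∈ S | c x ∈ insert i s} = {x ∈ S | c x = i} ∪ {x ∈ S | c x ∈ s} := by
        ext x; simp [and_or_left]
      rw [hu]
      rcases Set.eq_empty_or_nonempty {x ∈ S | c x = i} with h1 | h1
      · rw [h1, Set.empty_union]; exact ih ε hε
      rcases Set.eq_empty_or_nonempty {x ∈ S | c x ∈ s} with h2 | h2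
      · rw [h2, Set.union_empty]
        exact ⟨1, fun _ => 0, fun x hx y hy _ => (hT x hx y hy).trans (by linarith)⟩
      rw [convexHull_union h1 h2]
      refine ((ih (ε / 2) (half_pos hε)).join (R := R) (ε := ε / 2)
        (fun x hx y hy => (hT x hx y hy).trans (by linarith))
        (hb _ (Set.sep_subset _ _)) (hb _ (Set.sep_subset _ _)) (half_pos hε)).mono
        subset_rfl (by linarith)
  simpa using key Finset.univ ε hε

theorem dhKur_of_totallyBounded {X : Type*} [NormedAddCommGroup X] {S : Set X}
    (h : TotallyBounded S) {δ : ℝ} (hδ : 0 < δ) : dhKur S δ := by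
  obtain ⟨t, ht, hcov⟩ := Metric.totallyBounded_iff.1 h (δ / 2) (half_pos hδ)
  have : Finite t := ht
  refine dhKur_of' (ι := t) (fun x i => ‖x - i‖ < δ / 2) ?_ ?_
  · intro x hx
    have := hcov hx
    simp only [Set.mem_iUnion, mem_ball, dist_eq_norm] at this
    obtain ⟨i, hi, h⟩ := this
    exact ⟨⟨i, hi⟩, h⟩
  · intro x _ y _ i hx hy
    have : x - y = (x - i) - (y - i) := by abel
    rw [this]
    linarith [norm_sub_le (x - (i:X)) (y - i)]

theorem dh_totallyBounded {X : Type*} [NormedAddCommGroup X] {S : Set X}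
    (h : ∀ ε > 0, dhKur S ε) : TotallyBounded S := by
  refine Metric.totallyBounded_of_finite_discretization fun ε hε => ?_
  obtain ⟨n, c, hc⟩ := h (ε / 2) (half_pos hε)
  refine ⟨ULift (Fin n), inferInstance, fun x => ⟨c x⟩, fun x y e => ?_⟩
  have := hc x x.2 y y.2 (by simpa using e)
  have h2 : dist x y = ‖(x:X) - y‖ := dist_eq_norm (x:X) y
  exact lt_of_le_of_lt (le_of_eq_of_le h2 this) (half_lt_self hε)

theorem dh_contract {X : Type*} [NormedAddCommGroup X] {S : Set X} (k d0 : ℝ) (hk0 : 0 ≤ k)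
    (hk : k < 1) (hd0 : 0 ≤ d0) (h0 : dhKur S d0)
    (h : ∀ d, 0 ≤ d → dhKur S d → ∀ ε > 0, dhKur S (k * d + ε)) : ∀ ε > 0, dhKur S ε := by
  let D : Set ℝ := {d | 0 ≤ d ∧ dhKur S d}
  have hne : D.Nonempty := ⟨d0, hd0, h0⟩
  have hbdd : BddBelow D := ⟨0, fun d hd => hd.1⟩
  have hs0 : 0 ≤ sInf D := le_csInf hne fun d hd => hd.1
  have hs : sInf D = 0 := by
    by_contra hne0
    have hpos : 0 < sInf D := lt_of_le_of_ne hs0 (Ne.symm hne0)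
    set s := sInf D
    have hks : 0 < (1 - k) * s := mul_pos (by linarith) hpos
    obtain ⟨d, hd, hlt⟩ := exists_lt_of_csInf_lt hne (show s < s + (1 - k) * s / 2 by linarith)
    have h1 := h d hd.1 hd.2 ((1 - k) * s / 4) (by linarith)
    have h2 : s ≤ k * d + (1 - k) * s / 4 :=
      csInf_le hbdd ⟨by have := mul_nonneg hk0 hd.1; linarith, h1⟩
    have h3 : k * d ≤ k * (s + (1 - k) * s / 2) := by gcongr
    have h4 : k * ((1 - k) * s) ≤ 1 * ((1 - k) * s) := by gcongr
    nlinarith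
  intro ε hε
  obtain ⟨d, hd, hlt⟩ := exists_lt_of_csInf_lt hne (show sInf D < ε by rw [hs]; exact hε)
  exact hd.2.mono subset_rfl hlt.le

theorem dhage_existence
    {X : Type*} [NormedRing X] [NormedAlgebra ℝ X] [CompleteSpace X]
    (r : ℝ) (hr : 0 < r)
    (A B : X → X) (L_A M : ℝ)
    (hA : ∀ x ∈ Metric.closedBall (0:X) r, ∀ y ∈ Metric.closedBall (0:X) r,
      ‖A x - A y‖ ≤ L_A * ‖x - y‖)
    (hBcont : ContinuousOn B (Metric.closedBall (0:X) r))
    (hBcompact : IsCompact (closure (B '' Metric.closedBall (0:X) r)))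
    (hM : M = ⨆ x : Metric.closedBall (0:X) r, ‖B x‖)
    (hLM : L_A * M < 1)
    (hno : ∀ lam ∈ Set.Ioo (0:ℝ) 1, ∀ x : X, ‖x‖ = r → lam • (A x * B x) ≠ x) :
    ∃ x ∈ Metric.closedBall (0:X) r, A x * B x = x := by
  set U := Metric.closedBall (0:X) r with hU
  have h0U : (0:X) ∈ U := by simp [hU, hr.le]
  -- bounds
  have hBM : ∀ x ∈ U, ‖B x‖ ≤ M := by
    intro x hx
    obtain ⟨b, hb⟩ := hBcompact.isBounded.exists_norm_le
    rw [hM]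
    exact le_ciSup (f := fun x : U => ‖B x‖)
      ⟨b, by rintro _ ⟨y, rfl⟩; exact hb _ (subset_closure ⟨y, y.2, rfl⟩)⟩ ⟨x, hx⟩
  have hM0 : 0 ≤ M := (norm_nonneg _).trans (hBM 0 h0U)
  obtain ⟨L, hL0, hLM', hAL⟩ : ∃ L : ℝ, 0 ≤ L ∧ L * M < 1 ∧
      ∀ x ∈ U, ∀ y ∈ U, ‖A x - A y‖ ≤ L * ‖x - y‖ := by
    refine ⟨max L_A 0, le_max_right _ _, ?_, fun x hx y hy => (hA x hx y hy).trans ?_⟩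
    · rcases max_cases L_A 0 with ⟨e, -⟩ | ⟨e, -⟩ <;> rw [e]
      · exact hLM
      · simp
    · gcongr; exact le_max_left _ _
  set a := ‖A 0‖ + L * r with ha
  have ha0 : 0 ≤ a := by positivity
  have hAa : ∀ x ∈ U, ‖A x‖ ≤ a := by
    intro x hx
    have h1 := hAL x hx 0 h0U
    have h2 : ‖x‖ ≤ r := by simpa [hU] using hx
    have h3 := norm_sub_norm_le (A x) (A 0)
    rw [sub_zero] at h1
    have : L * ‖x‖ ≤ L * r := by gcongr
    linarith
  have hAcont : ContinuousOn A U := by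
    have : LipschitzOnWith (Real.toNNReal L) A U := by
      refine LipschitzOnWith.of_dist_le_mul fun x hx y hy => ?_
      rw [dist_eq_norm, dist_eq_norm, Real.coe_toNNReal _ hL0]
      exact hAL x hx y hy
    exact this.continuousOn
  set F : X → X := fun x => A x * B x with hF
  have hFcont : ContinuousOn F U := hAcont.mul hBcont
  have hFb : ∀ x ∈ U, ‖F x‖ ≤ a * M := fun x hx =>
    (norm_mul_le _ _).trans (mul_le_mul (hAa x hx) (hBM x hx) (norm_nonneg _) ha0)
  have hmaxpos : ∀ y : X, 0 < max r ‖y‖ := fun y => lt_max_of_lt_left hr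
  let ρ : X → X := fun y => (r / max r ‖y‖) • y
  have hρc : Continuous ρ := by
    have : Continuous fun y : X => r / max r ‖y‖ :=
      continuous_const.div (by fun_prop) (fun y => (hmaxpos y).ne')
    exact this.smul continuous_id
  have hρU : ∀ y, ρ y ∈ U := by
    intro y
    have := hmaxpos y
    simp only [hU, mem_closedBall, dist_zero_right, ρ]
    rw [norm_smul, Real.norm_of_nonneg (by positivity), div_mul_eq_mul_div, div_le_iff₀ this]
    gcongr; exact le_max_right _ _
  set G : X → X := fun x => ρ (F x) with hG
  have hGcont : ContinuousOn G U := hρc.comp_continuousOn hFcont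
  -- the smallest invariant set
  let fam : Set (Set X) := {C | IsClosed C ∧ Convex ℝ C ∧ (0:X) ∈ C ∧ Set.MapsTo G C C}
  let C : Set X := ⋂₀ fam
  have hUfam : U ∈ fam := ⟨isClosed_closedBall, convex_closedBall _ _, h0U, fun x _ => hρU _⟩
  have hCfam : C ∈ fam := by
    refine ⟨isClosed_sInter fun s hs => hs.1, convex_sInter fun s hs => hs.2.1,
      fun s hs => hs.2.2.1, fun x hx s hs => hs.2.2.2 (hx s hs)⟩
  have hCU : C ⊆ U := Set.sInter_subset_of_mem hUfam
  have hCsub : C ⊆ closure (convexHull ℝ (insert 0 (F '' C))) := by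
    set Q := closure (convexHull ℝ (insert 0 (F '' C))) with hQ
    have hQconv : Convex ℝ Q := (convex_convexHull ℝ _).closure
    have hsub : insert 0 (F '' C) ⊆ Q := (subset_convexHull ℝ _).trans subset_closure
    have h0Q : (0:X) ∈ Q := hsub (Set.mem_insert _ _)
    have hmem : C ∩ Q ∈ fam := by
      refine ⟨hCfam.1.inter isClosed_closure, hCfam.2.1.inter hQconv, ⟨hCfam.2.2.1, h0Q⟩, ?_⟩
      intro x hx
      refine ⟨hCfam.2.2.2 hx.1, ?_⟩
      have hFx : F x ∈ Q := hsub (Set.mem_insert_of_mem _ ⟨x, hx.1, rfl⟩)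
      have hm := hmaxpos (F x)
      exact hQconv.smul_mem_of_zero_mem h0Q hFx
        ⟨by positivity, (div_le_one hm).2 (le_max_left _ _)⟩
    exact (Set.sInter_subset_of_mem hmem).trans Set.inter_subset_right
  -- compactness of C
  have hBtb : TotallyBounded (B '' U) := hBcompact.totallyBounded.subset subset_closure
  have hstep : ∀ d, 0 ≤ d → dhKur C d → ∀ ε > 0, dhKur C (L * M * d + ε) := by
    intro d hd hCd ε hε
    have hFC : dhKur (F '' C) (L * M * d + ε / 3) := by
      obtain ⟨n, c, hc⟩ := hCd
      have hδ : 0 < ε / 3 / (a + 1) := by positivity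
      obtain ⟨n', c', hc'⟩ := dhKur_of_totallyBounded hBtb hδ
      refine dhKur_of' (ι := Fin n × Fin n')
        (fun y i => ∃ x ∈ C, F x = y ∧ c x = i.1 ∧ c' (B x) = i.2) ?_ ?_
      · rintro _ ⟨x, hx, rfl⟩
        exact ⟨(c x, c' (B x)), x, hx, rfl, rfl, rfl⟩
      · rintro _ - _ - ⟨i, j⟩ ⟨x, hx, rfl, hi, hj⟩ ⟨y, hy, rfl, hi', hj'⟩
        simp only at hi hj hi' hj'
        have h1 := hc x hx y hy (hi.trans hi'.symm)
        have h2 := hc' _ ⟨x, hCU hx, rfl⟩ _ ⟨y, hCU hy, rfl⟩ (hj.trans hj'.symm)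
        have h3 : ‖A x - A y‖ ≤ L * d := (hAL x (hCU hx) y (hCU hy)).trans (by gcongr)
        have h4 : a * (ε / 3 / (a + 1)) ≤ ε / 3 := by
          rw [mul_div_assoc', div_le_iff₀ (by positivity)]; nlinarith
        calc ‖F x - F y‖ = ‖(A x - A y) * B x + A y * (B x - B y)‖ := by
              congr 1; simp only [hF]; noncomm_ring
          _ ≤ ‖(A x - A y) * B x‖ + ‖A y * (B x - B y)‖ := norm_add_le _ _
          _ ≤ ‖A x - A y‖ * ‖B x‖ + ‖A y‖ * ‖B x - B y‖ :=
              add_le_add (norm_mul_le _ _) (norm_mul_le _ _)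
          _ ≤ (L * d) * M + a * (ε / 3 / (a + 1)) :=
              add_le_add (mul_le_mul h3 (hBM x (hCU hx)) (norm_nonneg _) (by positivity))
                (mul_le_mul (hAa y (hCU hy)) h2 (norm_nonneg _) ha0)
          _ ≤ L * M * d + ε / 3 := by linarith
    have hI := hFC.insert_pt (by positivity) (0:X)
    have hH := hI.hull (R := a * M) (ε := ε / 3) (by
      rintro _ (rfl | ⟨x, hx, rfl⟩)
      · simpa using mul_nonneg ha0 hM0
      · exact hFb x (hCU hx)) (by positivity)
    exact (hH.closure (ε := ε / 3) (by positivity)).mono hCsub (by linarith)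
  have hC0 : dhKur C (2 * r) := by
    refine ⟨1, fun _ => 0, fun x hx y hy _ => ?_⟩
    have h1 : ‖x‖ ≤ r := by simpa [hU] using hCU hx
    have h2 : ‖y‖ ≤ r := by simpa [hU] using hCU hy
    linarith [norm_sub_le x y]
  have hCtb : TotallyBounded C := dh_totallyBounded
    (dh_contract (L * M) (2 * r) (by positivity) hLM' (by positivity) hC0 hstep)
  have hCcpt : IsCompact C := hCtb.isCompact_of_isClosed hCfam.1
  obtain ⟨x, hxC, hx⟩ := dh_schauder C hCcpt hCfam.2.1 ⟨0, hCfam.2.2.1⟩ G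
    (hGcont.mono hCU) hCfam.2.2.2
  refine ⟨x, hCU hxC, ?_⟩
  have hx' : (r / max r ‖F x‖) • F x = x := hx
  rcases le_or_gt ‖F x‖ r with h | h
  · rw [max_eq_left h, div_self hr.ne', one_smul] at hx'
    exact hx'
  · exfalso
    rw [max_eq_right h.le] at hx'
    have hp : 0 < ‖F x‖ := hr.trans h
    refine hno (r / ‖F x‖) ⟨by positivity, (div_lt_one hp).2 h⟩ x ?_ hx'
    conv_lhs => rw [← hx']
    rw [norm_smul, Real.norm_of_nonneg (by positivity)]
    field_simp
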